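/- Let φ: ℙ_2 → ℙ_2 be a bijective continuous Jordan triple endomorphism (i.e., a continuous Jordan triple automorphism). Then φ is of one of the following two forms: (c1) there is a real number c ≠ -1/2 and a matrix U ∈ SU(2) such that φ(A) = (Det A)^c · U A U* for all A ∈ ℙ_2; (c2) there is a real number d ≠ 1/2 and a matrix V ∈ SU(2) such that φ(A) = (Det A)^d · V A^{-1} V* for all A ∈ ℙ_2. -/

import Mathlib

open Matrix ComplexOrder

section JTLemmas
open scoped Matrix.Norms.L2Operator MatrixOrder

section
variable {𝔸 : Type*} [NormedRing 𝔸] [NormOneClass 𝔸]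

lemma jt_pow_sub_pow (A B : 𝔸) (r : ℝ) (hr : 1 ≤ r) (hA : ‖A‖ ≤ r) (hB : ‖B‖ ≤ r) (n : ℕ) :
    ‖A ^ n - B ^ n‖ ≤ n * r ^ n * ‖A - B‖ := by
  induction n with
  | zero => simp
  | succ n ih =>
    have e : A ^ (n+1) - B ^ (n+1) = A ^ n * (A - B) + (A ^ n - B ^ n) * B := by
      rw [pow_succ, pow_succ]; noncomm_ring
    rw [e]
    have h0 : 0 ≤ r := by linarith
    have h1 : ‖A ^ n‖ ≤ r ^ n := (norm_pow_le A n).trans (by gcongr)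
    calc _ ≤ ‖A ^ n * (A - B)‖ + ‖(A ^ n - B ^ n) * B‖ := norm_add_le _ _
      _ ≤ ‖A^n‖ * ‖A - B‖ + ‖A ^ n - B ^ n‖ * ‖B‖ := by gcongr <;> exact norm_mul_le _ _
      _ ≤ r ^ n * ‖A - B‖ + (n * r ^ n * ‖A - B‖) * r := by gcongr
      _ ≤ r ^ n * r * ‖A - B‖ + (n * r ^ n * ‖A - B‖) * r := by
          gcongr; exact le_mul_of_one_le_right (by positivity) hr
      _ = _ := by push_cast; ring

open Filter Topology
lemma jt_trotter_aux [NormedAlgebra ℝ 𝔸] (A B : ℕ → 𝔸) (W : 𝔸)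
    (hA : Tendsto (fun n : ℕ => (n : ℝ) • (A n - 1)) atTop (𝓝 W))
    (hB : Tendsto (fun n : ℕ => (n : ℝ) • (B n - 1)) atTop (𝓝 W)) :
    Tendsto (fun n => A n ^ n - B n ^ n) atTop (𝓝 0) := by
  set C := ‖W‖ + 1
  have hC : 0 < C := by positivity
  have eA : ∀ᶠ n : ℕ in atTop, ‖(n : ℝ) • (A n - 1)‖ < C :=
    hA.norm.eventually (gt_mem_nhds (by simp [C]))
  have eB : ∀ᶠ n : ℕ in atTop, ‖(n : ℝ) • (B n - 1)‖ < C :=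
    hB.norm.eventually (gt_mem_nhds (by simp [C]))
  have hd : Tendsto (fun n : ℕ => Real.exp C * ‖(n : ℝ) • (A n - 1) - (n : ℝ) • (B n - 1)‖) atTop (𝓝 0) := by
    have := ((hA.sub hB).norm).const_mul (Real.exp C)
    simpa using this
  refine squeeze_zero_norm' ?_ hd
  filter_upwards [eA, eB, eventually_gt_atTop 0] with n h1 h2 hn
  have hn' : (0:ℝ) < n := by exact_mod_cast hn
  have key : ∀ X : 𝔸, ‖(n : ℝ) • (X - 1)‖ < C → ‖X‖ ≤ 1 + C / n := by
    intro X hX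
    rw [norm_smul, Real.norm_of_nonneg hn'.le] at hX
    have : ‖X - 1‖ ≤ C / n := by rw [le_div_iff₀ hn']; linarith
    calc ‖X‖ = ‖1 + (X - 1)‖ := by congr 1; abel
      _ ≤ ‖(1:𝔸)‖ + ‖X - 1‖ := norm_add_le _ _
      _ ≤ _ := by rw [norm_one]; gcongr
  have hp : (1 + C / n) ^ n ≤ Real.exp C := by
    calc (1 + C / n) ^ n ≤ (Real.exp (C / n)) ^ n := by
          gcongr; rw [add_comm]; exact Real.add_one_le_exp _
      _ = Real.exp C := by rw [← Real.exp_nat_mul]; congr 1; field_simp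
  have := jt_pow_sub_pow (A n) (B n) (1 + C / n) (by simp; positivity) (key _ h1) (key _ h2) n
  refine this.trans ?_
  rw [← smul_sub, norm_smul, Real.norm_of_nonneg hn'.le]
  have e : A n - 1 - (B n - 1) = A n - B n := by abel
  rw [e]
  calc _ = (1 + C / n) ^ n * (n * ‖A n - B n‖) := by ring
    _ ≤ _ := by gcongr

lemma jt_slope [NormedAlgebra ℝ 𝔸] (g : ℝ → 𝔸) (W : 𝔸) (h0 : g 0 = 1) (h : HasDerivAt g W 0) :
    Tendsto (fun n : ℕ => (n : ℝ) • (g ((n:ℝ)⁻¹) - 1)) atTop (𝓝 W) := by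
  have h1 := h.tendsto_slope
  have h2 : Tendsto (fun n : ℕ => ((n:ℝ)⁻¹)) atTop (𝓝[≠] 0) := by
    rw [tendsto_nhdsWithin_iff]
    refine ⟨tendsto_inv_atTop_nhds_zero_nat, ?_⟩
    filter_upwards [eventually_gt_atTop 0] with n hn
    simp; omega
  refine (h1.comp h2).congr ?_
  intro n
  simp [slope, h0]

lemma jt_trotter [NormedAlgebra ℝ 𝔸] [CompleteSpace 𝔸] (X Y : 𝔸) :
    Tendsto (fun n : ℕ => (NormedSpace.exp (((n:ℝ)⁻¹) • X) * NormedSpace.exp (((n:ℝ)⁻¹) • Y)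
      * NormedSpace.exp (((n:ℝ)⁻¹) • X)) ^ n) atTop (𝓝 (NormedSpace.exp (X + Y + X))) := by
  have dX := fun X : 𝔸 => by simpa using hasDerivAt_exp_smul_const (𝕂 := ℝ) X 0
  have h1 := jt_slope (fun t : ℝ => NormedSpace.exp (t • X) * NormedSpace.exp (t • Y) * NormedSpace.exp (t • X))
    (X + Y + X) (by simp) (by
      have := ((dX X).mul (dX Y)).mul (dX X)
      simp only [Pi.mul_apply, zero_smul, NormedSpace.exp_zero, mul_one, one_mul] at this
      exact this)
  have h2 := jt_slope (fun t : ℝ => NormedSpace.exp (t • (X + Y + X))) (X + Y + X) (by simp) (dX _)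
  have h3 := jt_trotter_aux _ _ _ h1 h2
  have h4 := h3.add_const (NormedSpace.exp (X + Y + X))
  rw [zero_add] at h4
  refine h4.congr' ?_
  filter_upwards [eventually_gt_atTop 0] with n hn
  have hn' : (n:ℝ) ≠ 0 := by positivity
  let _i : NormedAlgebra ℚ 𝔸 := NormedAlgebra.restrictScalars ℚ ℝ 𝔸
  have : NormedSpace.exp ((n:ℝ)⁻¹ • (X + Y + X)) ^ n = NormedSpace.exp (X + Y + X) := by
    rw [← NormedSpace.exp_nsmul, ← Nat.cast_smul_eq_nsmul ℝ, smul_smul, mul_inv_cancel₀ hn', one_smul]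
  rw [this, sub_add_cancel]
end

abbrev M2 := Matrix (Fin 2) (Fin 2) ℂ

lemma jt_exp_posDef (A : M2) (h : A.IsHermitian) : (NormedSpace.exp A).PosDef := by
  have h1 : IsStrictlyPositive (NormedSpace.exp A) := by
    rw [IsStrictlyPositive.iff_of_unital]
    exact ⟨IsSelfAdjoint.exp_nonneg h, Matrix.isUnit_exp A⟩
  exact h1.posDef
lemma jt_exp_log (A : M2) (h : A.PosDef) : NormedSpace.exp (CFC.log A) = A :=
  CFC.exp_log A h.isStrictlyPositive
lemma jt_log_exp (A : M2) (h : A.IsHermitian) : CFC.log (NormedSpace.exp A) = A :=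
  CFC.log_exp A h
lemma jt_log_herm (A : M2) : (CFC.log A).IsHermitian := IsSelfAdjoint.log
lemma jt_log_cont : ContinuousOn (CFC.log : M2 → M2) {A | A.PosDef} := by
  refine CFC.continuousOn_log.mono ?_
  intro A (hA : A.PosDef)
  exact ⟨hA.1, hA.isUnit⟩
lemma jt_exp_inj (A B : M2) (hA : A.IsHermitian) (hB : B.IsHermitian)
    (h : NormedSpace.exp A = NormedSpace.exp B) : A = B := by
  rw [← jt_log_exp A hA, h, jt_log_exp B hB]


lemma jt_linear (φ : M2 → M2)
    (hmaps : ∀ A : M2, A.PosDef → (φ A).PosDef)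
    (hcont : ContinuousOn φ {A : M2 | A.PosDef})
    (hjordan : ∀ A B : M2, A.PosDef → B.PosDef → φ (A * B * A) = φ A * φ B * φ A) :
    ∃ f : selfAdjoint M2 →L[ℝ] M2, ∀ X : selfAdjoint M2, (f X).IsHermitian ∧
      NormedSpace.exp (f X) = φ (NormedSpace.exp (X : M2)) := by
  have hX : ∀ X : selfAdjoint M2, (X : M2).IsHermitian := fun X => X.2
  have hpd : ∀ X : selfAdjoint M2, (NormedSpace.exp (X : M2)).PosDef :=
    fun X => jt_exp_posDef _ (hX X)
  set g : selfAdjoint M2 → M2 := fun X => CFC.log (φ (NormedSpace.exp (X : M2))) with hg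
  have hgh : ∀ X, (g X).IsHermitian := fun X => jt_log_herm _
  have hge : ∀ X, NormedSpace.exp (g X) = φ (NormedSpace.exp (X : M2)) :=
    fun X => jt_exp_log _ (hmaps _ (hpd X))
  have hgc : Continuous g := by
    have h1 : Continuous fun X : selfAdjoint M2 => NormedSpace.exp (X : M2) :=
      let _i : NormedAlgebra ℚ M2 := NormedAlgebra.restrictScalars ℚ ℝ M2
      NormedSpace.exp_continuous.comp continuous_subtype_val
    have h2 : Continuous fun X : selfAdjoint M2 => φ (NormedSpace.exp (X : M2)) :=
      hcont.comp_continuous h1 hpd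
    exact jt_log_cont.comp_continuous h2 (fun X => hmaps _ (hpd X))
  -- φ 1 = 1
  have hφ1 : φ 1 = 1 := by
    have h := hjordan 1 1 PosDef.one PosDef.one
    have hp := hmaps 1 PosDef.one
    simp only [mul_one] at h
    have hu := hp.isUnit
    have h2 : φ 1 * φ 1 = 1 := by
      have : φ 1 * φ 1 * φ 1 = 1 * φ 1 := by rw [one_mul]; exact h.symm
      exact hu.mul_right_cancel this
    have h3 : NormedSpace.exp (CFC.log (φ 1)) = φ 1 := jt_exp_log _ hp
    have h4 : NormedSpace.exp ((2:ℕ) • CFC.log (φ 1)) = NormedSpace.exp (0 : M2) := by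
      rw [Matrix.exp_nsmul, h3, NormedSpace.exp_zero, pow_two, h2]
    have h5 := jt_exp_inj _ _ (by rw [two_nsmul]; exact (jt_log_herm _).add (jt_log_herm _)) (by simp) h4
    rw [← Nat.cast_smul_eq_nsmul ℝ] at h5
    have h6 : CFC.log (φ 1) = 0 := (smul_eq_zero.1 h5).resolve_left (by norm_num)
    rw [← h3, h6, NormedSpace.exp_zero]
  have hpow : ∀ A : M2, A.PosDef → ∀ n : ℕ, φ (A ^ n) = φ A ^ n ∧ (A ^ n).PosDef := by
    intro A hA n
    have hAn : ∀ n : ℕ, (A ^ n).PosDef := by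
      intro n
      rw [← jt_exp_log A hA, ← Matrix.exp_nsmul]
      apply jt_exp_posDef
      have := (jt_log_herm A)
      rw [← Nat.cast_smul_eq_nsmul ℝ]
      exact IsSelfAdjoint.smul (by simp [IsSelfAdjoint]) this
    refine ⟨?_, hAn n⟩
    induction n using Nat.twoStepInduction with
    | zero => simpa using hφ1
    | one => simp
    | more n ih _ =>
      have e : A ^ (n+2) = A * A ^ n * A := by rw [← pow_succ', ← pow_succ]
      have e' : φ A ^ (n+2) = φ A * φ A ^ n * φ A := by rw [← pow_succ', ← pow_succ]
      rw [e, e', hjordan _ _ hA (hAn n), ih]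
  have hnsm : ∀ (n : ℕ) X, g (n • X) = n • g X := by
    intro n X
    apply jt_exp_inj _ _ (hgh _)
    · rw [← Nat.cast_smul_eq_nsmul ℝ]
      exact IsSelfAdjoint.smul (by simp [IsSelfAdjoint]) (hgh X)
    · rw [hge, Matrix.exp_nsmul, hge, ← (hpow _ (hpd X) n).1, ← Matrix.exp_nsmul]; rfl
  have hinv : ∀ (n : ℕ) X, 0 < n → g ((n:ℝ)⁻¹ • X) = (n:ℝ)⁻¹ • g X := by
    intro n X hn
    have hn' : (n:ℝ) ≠ 0 := by positivity
    have h := hnsm n ((n:ℝ)⁻¹ • X)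
    rw [← Nat.cast_smul_eq_nsmul ℝ, ← Nat.cast_smul_eq_nsmul ℝ, smul_smul, mul_inv_cancel₀ hn', one_smul] at h
    rw [h, smul_smul, inv_mul_cancel₀ hn', one_smul]
  have h3 : ∀ X Y, g (X + Y + X) = g X + g Y + g X := by
    intro X Y
    apply jt_exp_inj _ _ (hgh _) (((hgh X).add (hgh Y)).add (hgh X))
    have t1 := jt_trotter (X : M2) (Y : M2)
    have t2 := jt_trotter (g X) (g Y)
    have hc : ContinuousWithinAt φ {A : M2 | A.PosDef} (NormedSpace.exp ((X : M2) + Y + X)) :=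
      hcont _ (hpd (X + Y + X))
    have pdn : ∀ n : ℕ, (NormedSpace.exp (((n:ℝ)⁻¹) • (X:M2)) * NormedSpace.exp (((n:ℝ)⁻¹) • (Y:M2))
      * NormedSpace.exp (((n:ℝ)⁻¹) • (X:M2))).PosDef := by
      intro n
      have a1 : (NormedSpace.exp (((n:ℝ)⁻¹) • (X:M2))).PosDef := hpd (((n:ℝ)⁻¹) • X)
      have a2 : (NormedSpace.exp (((n:ℝ)⁻¹) • (Y:M2))).PosDef := hpd (((n:ℝ)⁻¹) • Y)
      have := a2.conjTranspose_mul_mul_same (B := NormedSpace.exp (((n:ℝ)⁻¹) • (X:M2))) 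
         (Matrix.mulVec_injective_of_isUnit a1.isUnit)
      rwa [a1.1.eq] at this
    have t3 : Filter.Tendsto (fun n : ℕ => φ ((NormedSpace.exp (((n:ℝ)⁻¹) • (X:M2)) * NormedSpace.exp (((n:ℝ)⁻¹) • (Y:M2))
      * NormedSpace.exp (((n:ℝ)⁻¹) • (X:M2))) ^ n)) Filter.atTop (nhds (φ (NormedSpace.exp ((X : M2) + Y + X)))) := by
      refine hc.tendsto.comp (tendsto_nhdsWithin_iff.2 ⟨t1, ?_⟩)
      exact Filter.Eventually.of_forall (fun n => (hpow _ (pdn n) n).2)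
    have e : NormedSpace.exp (g (X + Y + X)) = φ (NormedSpace.exp ((X : M2) + Y + X)) := hge _
    rw [e]
    refine tendsto_nhds_unique t3 (t2.congr' ?_)
    filter_upwards [Filter.eventually_gt_atTop 0] with n hn
    rw [(hpow _ (pdn n) n).1, ← hinv n X hn, ← hinv n Y hn, hge, hge]
    congr 1
    exact (hjordan _ _ (hpd (((n:ℝ)⁻¹) • X)) (hpd (((n:ℝ)⁻¹) • Y))).symm
  have h0 : g 0 = 0 := by simpa using hnsm 0 0
  have hadd : ∀ X Y, g (X + Y) = g X + g Y := by
    intro X Y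
    have e1 : g X = g ((2:ℝ)⁻¹ • X) + g ((2:ℝ)⁻¹ • X) := by
      have := h3 ((2:ℝ)⁻¹ • X) 0
      rw [h0, add_zero, add_zero, ← add_smul] at this
      norm_num at this
      simpa using this
    have := h3 ((2:ℝ)⁻¹ • X) Y
    have e2 : (2:ℝ)⁻¹ • X + Y + (2:ℝ)⁻¹ • X = X + Y := by
      rw [add_right_comm, ← add_smul]; norm_num
    rw [e2] at this
    rw [this, e1]; abel
  let G : selfAdjoint M2 →+ M2 := ⟨⟨g, h0⟩, hadd⟩
  exact ⟨G.toRealLinearMap hgc, fun X => ⟨hgh X, hge X⟩⟩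


abbrev E3 := EuclideanSpace ℝ (Fin 3)

noncomputable def jS : E3 →ₗ[ℝ] M2 where
  toFun v := !![(v 2 : ℂ), v 0 - Complex.I * v 1; v 0 + Complex.I * v 1, -(v 2 : ℂ)]
  map_add' v w := by
    ext i j; fin_cases i <;> fin_cases j <;> simp <;> ring
  map_smul' r v := by
    ext i j; fin_cases i <;> fin_cases j <;> simp <;> ring

noncomputable def jT : M2 →ₗ[ℝ] E3 where
  toFun A := !₂[(A 0 1).re, -(A 0 1).im, ((A 0 0).re - (A 1 1).re) / 2]
  map_add' v w := by
    ext i; fin_cases i <;> simp <;> ring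
  map_smul' r v := by
    ext i; fin_cases i <;> simp; ring

noncomputable def jt : M2 →ₗ[ℝ] ℝ where
  toFun A := ((A 0 0).re + (A 1 1).re) / 2
  map_add' v w := by simp; ring
  map_smul' r v := by simp; ring

lemma jS_apply (v : E3) : jS v = !![(v 2 : ℂ), v 0 - Complex.I * v 1; v 0 + Complex.I * v 1, -(v 2 : ℂ)] := rfl
lemma jT_apply (A : M2) : jT A = !₂[(A 0 1).re, -(A 0 1).im, ((A 0 0).re - (A 1 1).re) / 2] := rfl
lemma jt_apply (A : M2) : jt A = ((A 0 0).re + (A 1 1).re) / 2 := rfl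

lemma jS_herm (v : E3) : (jS v).IsHermitian := by
  ext i j; fin_cases i <;> fin_cases j <;> simp [jS_apply] <;> ring

lemma jTS (v : E3) : jT (jS v) = v := by
  ext i; fin_cases i <;> simp [jS_apply, jT_apply]
lemma jT1 : jT 1 = 0 := by
  ext i; fin_cases i <;> simp [jT_apply]
lemma jtS (v : E3) : jt (jS v) = 0 := by simp [jS_apply, jt_apply]
lemma jt1 : jt 1 = 1 := by simp [jt_apply]

lemma j_decomp (A : M2) (h : A.IsHermitian) : A = jt A • (1 : M2) + jS (jT A) := by
  have h00 := h.apply 0 0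
  have h11 := h.apply 1 1
  have h10 := h.apply 0 1
  have i0 : (A 0 0).im = 0 := by have := congrArg Complex.im h00; simp at this; linarith
  have i1 : (A 1 1).im = 0 := by have := congrArg Complex.im h11; simp at this; linarith
  have r1 : (A 1 0).re = (A 0 1).re := by have := congrArg Complex.re h10; simpa using this
  have r2 : (A 1 0).im = -(A 0 1).im := by have := congrArg Complex.im h10; simp at this; linarith
  ext i j; fin_cases i <;> fin_cases j <;> apply Complex.ext <;> simp [jS_apply, jT_apply, jt_apply, *] <;> ring

lemma jS_anti (v w : E3) : jS v * jS w + jS w * jS v = (2 * inner ℝ v w) • (1 : M2) := by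
  ext i j; fin_cases i <;> fin_cases j <;> apply Complex.ext <;>
    simp [jS_apply, PiLp.inner_apply, Fin.sum_univ_three] <;> ring

lemma jS_sq (v : E3) (hv : ‖v‖ = 1) : jS v * jS v = 1 := by
  have := jS_anti v v
  rw [real_inner_self_eq_norm_sq, hv, ← two_smul ℝ, mul_smul] at this
  simpa using this

lemma jS_anti0 (v w : E3) (h : inner ℝ v w = 0) : jS v * jS w = - (jS w * jS v) := by
  have := jS_anti v w
  rw [h] at this
  simp only [mul_zero, zero_smul] at this
  exact eq_neg_of_add_eq_zero_left this

lemma j_exp_invol (N : M2) (hN : N * N = 1) (t : ℝ) :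
    NormedSpace.exp (t • N) = Real.cosh t • (1 : M2) + Real.sinh t • N := by
  have h1 := (Real.hasSum_cosh t).smul_const (1 : M2)
  have h2 := (Real.hasSum_sinh t).smul_const N
  have hp : ∀ n : ℕ, N ^ (2 * n) = 1 := fun n => by rw [pow_mul, pow_two, hN, one_pow]
  have h := HasSum.even_add_odd (f := fun n : ℕ => ((n.factorial : ℝ)⁻¹) • (t • N) ^ n) (m := Real.cosh t • (1 : M2))
    (m' := Real.sinh t • N) (by
      convert h1 using 2 with n
      rw [smul_pow, hp, smul_smul]; congr 1; field_simp) (by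
      convert h2 using 2 with n
      rw [smul_pow, pow_succ N, hp, smul_smul, one_mul]; congr 1; field_simp)
  rw [NormedSpace.exp_eq_tsum ℝ]
  exact h.tsum_eq

lemma j_exp_unit (e : E3) (he : ‖e‖ = 1) (t : ℝ) :
    NormedSpace.exp (t • jS e) = Real.cosh t • (1 : M2) + Real.sinh t • jS e :=
  j_exp_invol _ (jS_sq e he) t

lemma j_exp_vec (v : E3) :
    NormedSpace.exp (jS v) = Real.cosh ‖v‖ • (1 : M2) + (Real.sinh ‖v‖ / ‖v‖) • jS v := by
  by_cases hv : v = 0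
  · simp [hv]
  have hn : ‖v‖ ≠ 0 := norm_ne_zero_iff.2 hv
  have := j_exp_unit (‖v‖⁻¹ • v) (by rw [norm_smul, norm_inv, norm_norm, inv_mul_cancel₀ hn]) ‖v‖
  rw [map_smul, smul_smul, smul_smul, mul_inv_cancel₀ hn, one_smul] at this
  rw [this, div_eq_mul_inv]

lemma j_log_vec (w : E3) :
    NormedSpace.exp ((Real.arsinh ‖w‖ / ‖w‖) • jS w) = √(1 + ‖w‖ ^ 2) • (1 : M2) + jS w := by
  by_cases hv : w = 0
  · simp [hv]
  have hn : ‖w‖ ≠ 0 := norm_ne_zero_iff.2 hv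
  have := j_exp_unit (‖w‖⁻¹ • w) (by rw [norm_smul, norm_inv, norm_norm, inv_mul_cancel₀ hn]) (Real.arsinh ‖w‖)
  rw [map_smul, smul_smul, smul_smul, Real.sinh_arsinh, Real.cosh_arsinh, mul_inv_cancel₀ hn, one_smul] at this
  rw [← this, div_eq_mul_inv]

lemma j_triple (e g : E3) (he : ‖e‖ = 1) (hg : ‖g‖ = 1) (h : inner ℝ e g = 0) (x y : ℝ) :
    NormedSpace.exp (x • jS e) * NormedSpace.exp (y • jS g) * NormedSpace.exp (x • jS e) =
    (Real.cosh y * Real.cosh (2 * x)) • (1 : M2) + jS ((Real.cosh y * Real.sinh (2 * x)) • e + Real.sinh y • g) := by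
  rw [j_exp_unit e he, j_exp_unit g hg]
  have h1 := jS_sq e he
  have h2 := jS_anti0 e g h
  have h3 : jS e * jS g * jS e = - jS g := by
    rw [h2, neg_mul, mul_assoc, h1, mul_one]
  have h4 := Real.cosh_sq x
  rw [map_add, map_smul, map_smul, Real.cosh_two_mul, Real.sinh_two_mul]
  simp only [mul_add, add_mul, smul_mul_assoc, mul_smul_comm, mul_one, one_mul, h1, h3, smul_smul]
  rw [h2]
  have h5 : Real.cosh x * Real.cosh x = Real.sinh x * Real.sinh x + 1 := by rw [← sq, h4]; ring
  match_scalars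
  · ring
  · ring
  · linear_combination (Real.sinh y) * h5
  · ring

lemma j_norm_w (e g : E3) (he : ‖e‖ = 1) (hg : ‖g‖ = 1) (h : inner ℝ e g = 0) (p q : ℝ) :
    ‖p • e + q • g‖ ^ 2 = p ^ 2 + q ^ 2 := by
  have h' : inner ℝ (p • e) (q • g) = 0 := by simp [inner_smul_left, inner_smul_right, h]
  have := norm_add_sq_eq_norm_sq_add_norm_sq_of_inner_eq_zero (p • e) (q • g) h'
  rw [norm_smul, norm_smul, he, hg] at this
  rw [sq, this, mul_one, mul_one, ← sq, ← sq, Real.norm_eq_abs, Real.norm_eq_abs, sq_abs, sq_abs]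

lemma j_sqrt (e g : E3) (he : ‖e‖ = 1) (hg : ‖g‖ = 1) (h : inner ℝ e g = 0) (x y : ℝ) :
    √(1 + ‖(Real.cosh y * Real.sinh x) • e + Real.sinh y • g‖ ^ 2) = Real.cosh y * Real.cosh x := by
  rw [j_norm_w e g he hg h]
  have : 1 + ((Real.cosh y * Real.sinh x) ^ 2 + Real.sinh y ^ 2) = (Real.cosh y * Real.cosh x) ^ 2 := by
    rw [mul_pow, mul_pow, Real.cosh_sq x, Real.cosh_sq y]; ring
  rw [this, Real.sqrt_sq (by positivity)]

/-- scalar rigidity -/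
lemma j_scalar (a b : ℝ) (ha : 0 < a) (hb : 0 < b)
    (h : ∀ x y : ℝ, a * Real.cosh y * Real.sinh x * Real.sinh (b * y) =
      b * Real.sinh y * Real.cosh (b * y) * Real.sinh (a * x)) : a = 1 ∧ b = 1 := by
  have s1 : 0 < Real.sinh 1 := Real.sinh_pos_iff.2 one_pos
  have sa : 0 < Real.sinh a := Real.sinh_pos_iff.2 ha
  have sb : 0 < Real.sinh b := Real.sinh_pos_iff.2 hb
  have c1 := Real.cosh_pos 1
  have ca := Real.cosh_pos a
  have cb := Real.cosh_pos b
  have h1 := h 1 1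
  have h2 := h 2 1
  have h3 := h 1 2
  have e1 : Real.sinh 2 = 2 * Real.sinh 1 * Real.cosh 1 := by rw [← Real.sinh_two_mul]; norm_num
  have e2 : Real.cosh 2 = Real.cosh 1 ^ 2 + Real.sinh 1 ^ 2 := by rw [← Real.cosh_two_mul]; norm_num
  have ea : Real.sinh (a * 2) = 2 * Real.sinh a * Real.cosh a := by rw [mul_comm, Real.sinh_two_mul]
  have eb : Real.sinh (b * 2) = 2 * Real.sinh b * Real.cosh b := by rw [mul_comm, Real.sinh_two_mul]
  have eb' : Real.cosh (b * 2) = Real.cosh b ^ 2 + Real.sinh b ^ 2 := by rw [mul_comm, Real.cosh_two_mul]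
  rw [mul_one, mul_one] at h1
  rw [mul_one, ea, e1] at h2
  have hc : Real.cosh a = Real.cosh 1 := by
    have : (b * Real.sinh 1 * Real.cosh b * Real.sinh a * 2) * (Real.cosh 1 - Real.cosh a) = 0 := by
      linear_combination h2 - 2 * Real.cosh 1 * h1
    rcases mul_eq_zero.1 this with h | h
    · exact absurd h (by positivity)
    · linarith
  have ha1 : a = 1 := by
    have := Real.cosh_injOn.eq_iff (Set.mem_Ici.2 ha.le) (Set.mem_Ici.2 zero_le_one) |>.1 hc
    exact this
  subst ha1
  refine ⟨rfl, ?_⟩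
  have g1 : Real.cosh 1 * Real.sinh b = b * Real.sinh 1 * Real.cosh b := by
    apply mul_right_cancel₀ s1.ne'; linear_combination h1
  have g2 : Real.cosh 2 * Real.sinh (b * 2) = b * Real.sinh 2 * Real.cosh (b * 2) := by
    apply mul_right_cancel₀ s1.ne'; rw [mul_one] at h3; linear_combination h3
  rw [e1, e2, eb, eb'] at g2
  have k1 := Real.cosh_sq 1
  have k2 := Real.cosh_sq b
  have k3 : Real.cosh 1 * Real.sinh b = Real.sinh 1 * Real.cosh b := by
    have : (2 * Real.sinh b) * ((Real.sinh 1 * Real.cosh b)^2 - (Real.cosh 1 * Real.sinh b)^2) = 0 := by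
      linear_combination Real.cosh b * g2 - 2 * Real.cosh 1 * (Real.cosh b ^ 2 + Real.sinh b ^ 2) * g1
    have hsq : (Real.cosh 1 * Real.sinh b)^2 = (Real.sinh 1 * Real.cosh b)^2 := by
      rcases mul_eq_zero.1 this with h | h
      · exact absurd h (by positivity)
      · linarith
    exact (sq_eq_sq₀ (by positivity) (by positivity)).1 hsq
  have : (b - 1) * (Real.sinh 1 * Real.cosh b) = 0 := by linear_combination k3 - g1
  rcases mul_eq_zero.1 this with h | h
  · linarith
  · exact absurd h (by positivity)


/-- core relation -/
lemma j_core (L : E3 →ₗ[ℝ] E3) (τ : E3 →ₗ[ℝ] ℝ)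
    (hrel : ∀ u v w : E3, NormedSpace.exp (jS u) * NormedSpace.exp (jS v) * NormedSpace.exp (jS u) = NormedSpace.exp (jS w) →
      Real.exp (τ w) • NormedSpace.exp (jS (L w)) = (Real.exp (τ u) * Real.exp (τ v) * Real.exp (τ u)) •
        (NormedSpace.exp (jS (L u)) * NormedSpace.exp (jS (L v)) * NormedSpace.exp (jS (L u))))
    (hLinj : ∀ v, L v = 0 → v = 0) :
    (∀ v, ‖L v‖ = ‖v‖) ∧ τ = 0 := by
  -- relation for orthonormal pairs
  have hbase : ∀ e g : E3, ‖e‖ = 1 → ‖g‖ = 1 → inner ℝ e g = 0 → ∀ x y : ℝ,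
      let w := (Real.cosh y * Real.sinh (2 * x)) • e + Real.sinh y • g
      let κ := Real.arsinh ‖w‖ / ‖w‖
      Real.exp (τ (κ • w)) • NormedSpace.exp (jS (L (κ • w))) =
        (Real.exp (τ (x • e)) * Real.exp (τ (y • g)) * Real.exp (τ (x • e))) •
        (NormedSpace.exp (jS (L (x • e))) * NormedSpace.exp (jS (L (y • g))) * NormedSpace.exp (jS (L (x • e)))) := by
    intro e g he hg h x y w κ
    apply hrel
    rw [map_smul, map_smul, map_smul, j_triple e g he hg h, j_log_vec, j_sqrt e g he hg h]
  have hab : ∀ e g : E3, ‖e‖ = 1 → ‖g‖ = 1 → inner ℝ e g = 0 → inner ℝ (L e) (L g) = 0 →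
      ‖L e‖ = 1 ∧ ‖L g‖ = 1 := by
    intro e g he hg h hL
    have ha : 0 < ‖L e‖ := norm_pos_iff.2 (fun h0 => by simp [hLinj e h0] at he)
    have hb : 0 < ‖L g‖ := norm_pos_iff.2 (fun h0 => by simp [hLinj g h0] at hg)
    set a := ‖L e‖ with hadef
    set b := ‖L g‖ with hbdef
    set p := a⁻¹ • L e with hp
    set q := b⁻¹ • L g with hq
    have hp1 : ‖p‖ = 1 := by rw [hp, norm_smul, norm_inv, hadef, norm_norm, inv_mul_cancel₀ ha.ne']
    have hq1 : ‖q‖ = 1 := by rw [hq, norm_smul, norm_inv, hbdef, norm_norm, inv_mul_cancel₀ hb.ne']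
    have hpq : inner ℝ p q = 0 := by simp [hp, hq, inner_smul_left, inner_smul_right, hL]
    have hLe : L e = a • p := by rw [hp, smul_smul, mul_inv_cancel₀ ha.ne', one_smul]
    have hLg : L g = b • q := by rw [hq, smul_smul, mul_inv_cancel₀ hb.ne', one_smul]
    apply j_scalar a b ha hb
    intro x' y
    obtain ⟨x, rfl⟩ : ∃ x, x' = 2 * x := ⟨x' / 2, by ring⟩
    by_cases hy : y = 0
    · simp [hy]
    have hb1 := hbase e g he hg h x y
    simp only at hb1
    set w := (Real.cosh y * Real.sinh (2 * x)) • e + Real.sinh y • g with hw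
    set κ := Real.arsinh ‖w‖ / ‖w‖
    set K := (Real.exp (τ (x • e)) * Real.exp (τ (y • g)) * Real.exp (τ (x • e))) with hK
    have hK0 : 0 < K := by positivity
    rw [j_exp_vec] at hb1
    have e1 : jS (L (x • e)) = (a * x) • jS p := by rw [map_smul, hLe, smul_smul, map_smul, mul_comm]
    have e2 : jS (L (y • g)) = (b * y) • jS q := by rw [map_smul, hLg, smul_smul, map_smul, mul_comm]
    rw [e1, e2, j_triple p q hp1 hq1 hpq] at hb1
    obtain ⟨ρ, hρ⟩ : ∃ ρ : ℝ, ρ • L w = (K * (Real.cosh (b * y) * Real.sinh (2 * (a * x)))) • p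
        + (K * Real.sinh (b * y)) • q := by
      have hb2 := congrArg jT hb1
      simp only [map_smul, map_add, jTS, jT1, smul_zero, zero_add, smul_add, smul_smul] at hb2
      exact ⟨_, hb2⟩
    have hLw : L w = (Real.cosh y * Real.sinh (2 * x) * a) • p + (Real.sinh y * b) • q := by
      rw [hw, map_add, map_smul, map_smul, hLe, hLg, mul_smul _ a p, mul_smul _ b q]
    rw [hLw] at hρ
    have qp : inner ℝ q p = 0 := by rw [real_inner_comm, hpq]
    have c1 := congrArg (fun v => inner ℝ v p) hρ
    have c2 := congrArg (fun v => inner ℝ v q) hρ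
    simp only [inner_add_left, inner_smul_left, smul_add, real_inner_self_eq_norm_sq, hp1, hq1, hpq, qp,
      RCLike.conj_to_real, one_pow, mul_one, mul_zero, add_zero, zero_add] at c1 c2
    have sby : Real.sinh (b * y) ≠ 0 := by
      rw [Ne, Real.sinh_eq_zero]; exact mul_ne_zero hb.ne' hy
    have hρ0 : ρ ≠ 0 := by
      rintro rfl
      rw [zero_mul] at c2
      exact mul_ne_zero hK0.ne' sby c2.symm
    have e3 : a * (2 * x) = 2 * (a * x) := by ring
    rw [e3]
    apply mul_left_cancel₀ (mul_ne_zero hρ0 hK0.ne')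
    linear_combination K * Real.sinh (b * y) * c1 - K * Real.cosh (b * y) * Real.sinh (2 * (a * x)) * c2
  -- an eigenvector of the Gram operator
  have hiso : ∀ v, ‖L v‖ = ‖v‖ := by
    have hsym : (LinearMap.adjoint L ∘ₗ L).IsSymmetric := LinearMap.isSymmetric_adjoint_comp_self L
    obtain ⟨e₀, he₀⟩ := (hsym.hasEigenvalue_iSup_of_finiteDimensional).exists_hasEigenvector
    have he0 : e₀ ≠ 0 := he₀.2
    have heig := he₀.apply_eq_smul
    generalize ((⨆ x : {x : E3 // x ≠ 0}, RCLike.re (inner ℝ ((LinearMap.adjoint L ∘ₗ L) ↑x) (x:E3)) / ‖(x:E3)‖ ^ 2 : ℝ)) = μ at heig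
    have hn : ‖e₀‖ ≠ 0 := norm_ne_zero_iff.2 he0
    set e := ‖e₀‖⁻¹ • e₀ with he
    have he1 : ‖e‖ = 1 := by rw [he, norm_smul, norm_inv, norm_norm, inv_mul_cancel₀ hn]
    have horth : ∀ g, inner ℝ e g = 0 → inner ℝ (L e) (L g) = 0 := by
      intro g hg
      have h1 : inner ℝ e₀ g = 0 := by
        rw [he, inner_smul_left] at hg
        rcases mul_eq_zero.1 hg with h | h
        · simp at h; exact absurd h he0
        · exact h
      have h2 : inner ℝ (L e₀) (L g) = 0 := by
        rw [← LinearMap.adjoint_inner_left]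
        have : (LinearMap.adjoint L) (L e₀) = _ := heig
        rw [this, inner_smul_left, h1, mul_zero]
      rw [he, map_smul, inner_smul_left, h2, mul_zero]
    have horthn : ∀ g, inner ℝ e g = 0 → ‖L g‖ = ‖g‖ := by
      intro g hg
      by_cases g0 : g = 0
      · simp [g0]
      have gn : ‖g‖ ≠ 0 := norm_ne_zero_iff.2 g0
      have hz : inner ℝ e (‖g‖⁻¹ • g) = 0 := by rw [inner_smul_right, hg, mul_zero]
      have := (hab e (‖g‖⁻¹ • g) he1 (by rw [norm_smul, norm_inv, norm_norm, inv_mul_cancel₀ gn]) hz (horth _ hz)).2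
      rw [map_smul, norm_smul, norm_inv, norm_norm] at this
      field_simp at this
      exact this
    have hLe1 : ‖L e‖ = 1 := by
      obtain ⟨g, hg0, hg⟩ : ∃ g : E3, g ≠ 0 ∧ inner ℝ e g = 0 := by
        by_cases h : e 0 = 0 ∧ e 1 = 0
        · refine ⟨!₂[1, 0, 0], ?_, ?_⟩
          · intro h; have := congrArg (fun v : E3 => v 0) h; simp at this
          · simp [PiLp.inner_apply, Fin.sum_univ_three, h]
        · refine ⟨!₂[e 1, - e 0, 0], ?_, ?_⟩
          · intro h'
            have h1 := congrArg (fun v : E3 => v 0) h'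
            have h2 := congrArg (fun v : E3 => v 1) h'
            simp at h1 h2; exact h ⟨h2, h1⟩
          · simp [PiLp.inner_apply, Fin.sum_univ_three]; ring
      have gn : ‖g‖ ≠ 0 := norm_ne_zero_iff.2 hg0
      have hz : inner ℝ e (‖g‖⁻¹ • g) = 0 := by rw [inner_smul_right, hg, mul_zero]
      exact (hab e (‖g‖⁻¹ • g) he1 (by rw [norm_smul, norm_inv, norm_norm, inv_mul_cancel₀ gn]) hz (horth _ hz)).1
    intro v
    set c := inner ℝ e v with hc
    set g := v - c • e with hg
    have hv : v = c • e + g := by rw [hg]; abel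
    have hz : inner ℝ e g = 0 := by
      rw [hg, inner_sub_right, inner_smul_right, real_inner_self_eq_norm_sq, he1, ← hc]; ring
    have n1 := norm_add_sq_eq_norm_sq_add_norm_sq_of_inner_eq_zero (c • e) g (by rw [inner_smul_left, hz, mul_zero])
    have n2 := norm_add_sq_eq_norm_sq_add_norm_sq_of_inner_eq_zero (c • L e) (L g) (by rw [inner_smul_left, horth g hz, mul_zero])
    rw [← map_smul, ← map_add, ← hv, map_smul, norm_smul, hLe1, horthn g hz] at n2
    rw [← hv, norm_smul, he1] at n1
    have : ‖L v‖ * ‖L v‖ = ‖v‖ * ‖v‖ := by rw [n1, n2]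
    exact (mul_self_inj (norm_nonneg _) (norm_nonneg _)).1 this
  refine ⟨hiso, ?_⟩
  have hLinn : ∀ v w, inner ℝ (L v) (L w) = inner ℝ v w := by
    intro v w
    exact (LinearIsometry.inner_map_map (⟨L, hiso⟩ : E3 →ₗᵢ[ℝ] E3) v w)
  have hτ : ∀ e g : E3, ‖e‖ = 1 → ‖g‖ = 1 → inner ℝ e g = 0 → τ g = 0 := by
    intro e g he hg h
    have key : ∀ g : E3, ‖g‖ = 1 → inner ℝ e g = 0 → ∀ x y : ℝ, 
        Real.cosh y * Real.cosh (2 * x) = Real.cosh (2 * y) → 0 < y →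
        2 * y / Real.sinh (2 * y) * (Real.cosh y * Real.sinh (2 * x) * τ e + Real.sinh y * τ g) = 2 * x * τ e + y * τ g := by
      intro g hg h x y hxy hy
      have hb1 := hbase e g he hg h x y
      simp only at hb1
      set w := (Real.cosh y * Real.sinh (2 * x)) • e + Real.sinh y • g with hw
      have hs : 0 < Real.sinh (2 * y) := Real.sinh_pos_iff.2 (by linarith)
      have hwn : ‖w‖ = Real.sinh (2 * y) := by
        have h1 := j_sqrt e g he hg h (2 * x) y
        rw [← hw, hxy, Real.sqrt_eq_iff_mul_self_eq (by positivity) (by positivity)] at h1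
        have h2 := Real.cosh_sq (2 * y)
        have : ‖w‖ ^ 2 = Real.sinh (2 * y) ^ 2 := by linarith [h1, h2, sq (Real.cosh (2*y))]
        exact (sq_eq_sq₀ (norm_nonneg _) hs.le).1 this
      have hLw : L w = (Real.cosh y * Real.sinh (2 * x)) • L e + Real.sinh y • L g := by
        rw [hw, map_add, map_smul, map_smul]
      have lhs : NormedSpace.exp (jS (L ((Real.arsinh ‖w‖ / ‖w‖) • w))) = (Real.cosh y * Real.cosh (2 * x)) • (1 : M2) + jS (L w) := by
        rw [map_smul, map_smul, ← hiso w, j_log_vec, hiso w, j_sqrt e g he hg h]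
      have rhs : NormedSpace.exp (jS (L (x • e))) * NormedSpace.exp (jS (L (y • g))) * NormedSpace.exp (jS (L (x • e)))
          = (Real.cosh y * Real.cosh (2 * x)) • (1 : M2) + jS (L w) := by
        rw [map_smul, map_smul, map_smul, map_smul, j_triple (L e) (L g) (by rw [hiso, he]) (by rw [hiso, hg]) (by rw [hLinn, h]), hLw]
      rw [lhs, rhs] at hb1
      have hb2 := congrArg jt hb1
      simp only [map_smul, map_add, jtS, jt1, smul_eq_mul, mul_one, add_zero] at hb2
      have hb3 := mul_right_cancel₀ (by positivity) hb2
      rw [← Real.exp_add, ← Real.exp_add, Real.exp_eq_exp, hwn, Real.arsinh_sinh] at hb3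
      rw [hw] at hb3
      simp only [map_add, map_smul, smul_eq_mul] at hb3
      rw [hb3]; ring
    have c1 := Real.cosh_pos 1
    have s1 : 0 < Real.sinh 1 := Real.sinh_pos_iff.2 one_pos
    have e2 : Real.cosh 2 = Real.cosh 1 ^ 2 + Real.sinh 1 ^ 2 := by rw [← Real.cosh_two_mul]; norm_num
    have e1 : Real.sinh 2 = 2 * Real.sinh 1 * Real.cosh 1 := by rw [← Real.sinh_two_mul]; norm_num
    have k1 := Real.cosh_sq 1
    have c1' : 1 < Real.cosh 1 := Real.one_lt_cosh.2 one_ne_zero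
    obtain ⟨x, hx⟩ : ∃ x, Real.cosh 1 * Real.cosh (2 * x) = Real.cosh (2 * 1) := by
      refine ⟨Real.arcosh (Real.cosh 2 / Real.cosh 1) / 2, ?_⟩
      rw [mul_div_cancel₀ _ two_ne_zero, Real.cosh_arcosh, mul_one, mul_div_cancel₀ _ c1.ne']
      rw [le_div_iff₀ c1, e2]; nlinarith
    have k2 := key g hg h x 1 hx one_pos
    have k3 := key (-g) (by rw [norm_neg, hg]) (by rw [inner_neg_right, h, neg_zero]) x 1 hx one_pos
    rw [map_neg] at k3
    have k4 : 2 * 1 / Real.sinh (2 * 1) * (Real.sinh 1 * τ g) = τ g := by linear_combination (k2 - k3) / 2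
    rw [mul_one, e1] at k4
    field_simp at k4
    by_contra hne
    have : (Real.cosh 1 - 1) * τ g = 0 := by linear_combination -k4
    rcases mul_eq_zero.1 this with h | h
    · linarith
    · exact hne h
  have b0 : ∀ i j : Fin 3, i ≠ j → τ (EuclideanSpace.single i (1:ℝ)) = 0 := by
    intro i j hij
    apply hτ (EuclideanSpace.single j (1:ℝ)) _ (by simp) (by simp)
    simp [EuclideanSpace.inner_single_left, hij.symm]
  apply (EuclideanSpace.basisFun (Fin 3) ℝ).toBasis.ext
  intro i
  simp only [OrthonormalBasis.coe_toBasis, EuclideanSpace.basisFun_apply, LinearMap.zero_apply]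
  exact b0 i (i + 1) (by fin_cases i <;> decide)


lemma j_U (m n : E3) (hm : ‖m‖ = 1) (hn : ‖n‖ = 1) (hmn : inner ℝ m n = 0) :
    ∃ U : M2, U * Uᴴ = 1 ∧ Uᴴ * U = 1 ∧ U.det = 1 ∧ jS m * U = U * !![0, 1; 1, 0] ∧
      jS n * U = U * !![1, 0; 0, -1] := by
  have hdet : (jS n - 1).det = 0 := by
    have h1 : ‖n‖ ^ 2 = 1 := by rw [hn]; norm_num
    rw [EuclideanSpace.norm_sq_eq, Fin.sum_univ_three] at h1
    simp only [Real.norm_eq_abs, sq_abs] at h1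
    have h2 : ((n 0 : ℂ)) ^ 2 + (n 1 : ℂ) ^ 2 + (n 2 : ℂ) ^ 2 = 1 := by exact_mod_cast h1
    simp [Matrix.det_fin_two, jS_apply]
    linear_combination -h2 + (n 1 : ℂ)^2 * Complex.I_sq
  obtain ⟨v, hv0, hv⟩ := Matrix.exists_mulVec_eq_zero_iff.2 hdet
  rw [Matrix.sub_mulVec, one_mulVec, sub_eq_zero] at hv
  have hsq := jS_sq m hm
  have hanti := jS_anti0 n m (by rw [real_inner_comm, hmn])
  set F1 := jS m with hF1
  set F3 := jS n with hF3
  set w := F1 *ᵥ v with hw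
  have hw1 : F1 *ᵥ w = v := by rw [hw, mulVec_mulVec, hsq, one_mulVec]
  have hw3 : F3 *ᵥ w = -w := by
    rw [hw, mulVec_mulVec, hanti, neg_mulVec, ← mulVec_mulVec, hv]
  set U₀ : M2 := !![v 0, w 0; v 1, w 1] with hU₀
  have hU1 : F1 * U₀ = U₀ * !![0, 1; 1, 0] := by
    have a0 := congrFun hw 0
    have a1 := congrFun hw 1
    have b0 := congrFun hw1 0
    have b1 := congrFun hw1 1
    simp only [mulVec, dotProduct, Fin.sum_univ_two] at a0 a1 b0 b1
    ext i j; fin_cases i <;> fin_cases j <;> simp [hU₀, Matrix.mul_apply, Fin.sum_univ_two, ← a0, ← a1, b0, b1]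
  have hU3 : F3 * U₀ = U₀ * !![1, 0; 0, -1] := by
    have a0 := congrFun hv 0
    have a1 := congrFun hv 1
    have b0 := congrFun hw3 0
    have b1 := congrFun hw3 1
    simp only [mulVec, dotProduct, Fin.sum_univ_two] at a0 a1 b0 b1
    ext i j; fin_cases i <;> fin_cases j <;> simp [hU₀, Matrix.mul_apply, Fin.sum_univ_two, a0, a1, b0, b1]
  have hcomm : ∀ F σ : M2, F.IsHermitian → σ.IsHermitian → F * U₀ = U₀ * σ → (U₀ᴴ * U₀) * σ = σ * (U₀ᴴ * U₀) := by
    intro F σ hF hσ h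
    have h' := congrArg conjTranspose h
    rw [conjTranspose_mul, conjTranspose_mul, hF.eq, hσ.eq] at h'
    rw [mul_assoc, ← h, ← mul_assoc, h', mul_assoc]
  have hP1 := hcomm F1 !![0,1;1,0] (jS_herm m) (by ext i j; fin_cases i <;> fin_cases j <;> simp) hU1
  have hP3 := hcomm F3 !![1,0;0,-1] (jS_herm n) (by ext i j; fin_cases i <;> fin_cases j <;> simp) hU3
  set P := U₀ᴴ * U₀ with hP
  have p1 : P 0 1 = 0 := by
    have := congrFun (congrFun hP3 0) 1
    simp [Matrix.mul_apply, Fin.sum_univ_two] at this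
    linear_combination -(1/2) * this
  have p2 : P 1 0 = 0 := by
    have := congrFun (congrFun hP3 1) 0
    simp [Matrix.mul_apply, Fin.sum_univ_two] at this
    linear_combination (1/2) * this
  have p3 : P 1 1 = P 0 0 := by
    have := congrFun (congrFun hP1 0) 1
    simp [Matrix.mul_apply, Fin.sum_univ_two] at this
    exact this.symm
  set s : ℝ := ‖v 0‖ ^ 2 + ‖v 1‖ ^ 2 with hs
  have p0 : P 0 0 = (s : ℂ) := by
    simp [hP, hU₀, Matrix.mul_apply, Fin.sum_univ_two, hs, Complex.conj_mul']
  have hspos : 0 < s := by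
    by_contra hneg
    have h1 : ‖v 0‖ ^ 2 = 0 := by nlinarith [sq_nonneg ‖v 0‖, sq_nonneg ‖v 1‖]
    have h2 : ‖v 1‖ ^ 2 = 0 := by nlinarith [sq_nonneg ‖v 0‖, sq_nonneg ‖v 1‖]
    apply hv0
    ext i; fin_cases i
    · simpa using h1
    · simpa using h2
  have hPs : P = (s : ℂ) • (1 : M2) := by
    ext i j; fin_cases i <;> fin_cases j <;> simp [p0, p1, p2, p3]
  have hd : ‖U₀.det‖ ^ 2 = s ^ 2 := by
    have h := congrArg Matrix.det hPs
    rw [hP, det_mul, det_conjTranspose, det_smul, det_one, Fintype.card_fin, mul_one] at h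
    have : ((‖U₀.det‖ ^ 2 : ℝ) : ℂ) = ((s ^ 2 : ℝ) : ℂ) := by
      push_cast; rw [← h, ← Complex.conj_mul']; rfl
    exact_mod_cast this
  have hd' : ‖U₀.det‖ = s := (sq_eq_sq₀ (norm_nonneg _) hspos.le).1 hd
  have hd0 : U₀.det ≠ 0 := by rw [← norm_ne_zero_iff, hd']; exact hspos.ne'
  obtain ⟨ζ, hζ⟩ := IsAlgClosed.exists_pow_nat_eq (U₀.det)⁻¹ (n := 2) two_pos
  have hζn : ‖ζ‖ ^ 2 = s⁻¹ := by rw [← norm_pow, hζ, norm_inv, hd']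
  have hUU : (ζ • U₀)ᴴ * (ζ • U₀) = 1 := by
    rw [conjTranspose_smul, smul_mul_smul_comm, ← hP, hPs, smul_smul]
    have : star ζ * ζ * (s : ℂ) = 1 := by
      have h1 : star ζ * ζ = ((‖ζ‖ ^ 2 : ℝ) : ℂ) := by push_cast; rw [← Complex.conj_mul']; rfl
      rw [h1, hζn, ← Complex.ofReal_mul, inv_mul_cancel₀ hspos.ne', Complex.ofReal_one]
    rw [this, one_smul]
  refine ⟨ζ • U₀, mul_eq_one_comm.1 hUU, hUU, ?_, ?_, ?_⟩
  · rw [det_smul, Fintype.card_fin, hζ, inv_mul_cancel₀ hd0]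
  · rw [mul_smul_comm, hU1, smul_mul_assoc]
  · rw [mul_smul_comm, hU3, smul_mul_assoc]

lemma jS_trace (v : E3) : (jS v).trace = 0 := by simp [jS_apply, Matrix.trace, Fin.sum_univ_two]

lemma jS_basis (v : E3) : jS v = v 0 • (!![0,1;1,0] : M2) + v 1 • (!![0,-Complex.I; Complex.I,0] : M2)
    + v 2 • (!![1,0;0,-1] : M2) := by
  ext i j; fin_cases i <;> fin_cases j <;> simp [jS_apply] <;> ring

lemma j_lift (L : E3 →ₗ[ℝ] E3) (hL : ∀ v, ‖L v‖ = ‖v‖) :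
    ∃ U : M2, U * Uᴴ = 1 ∧ Uᴴ * U = 1 ∧ U.det = 1 ∧
      ((∀ v, jS (L v) = U * jS v * Uᴴ) ∨ (∀ v, jS (L v) = U * (-jS v) * Uᴴ)) := by
  have hLinn : ∀ v w, inner ℝ (L v) (L w) = inner ℝ v w := by
    intro v w
    exact (LinearIsometry.inner_map_map (⟨L, hL⟩ : E3 →ₗᵢ[ℝ] E3) v w)
  set b : Fin 3 → E3 := fun i => EuclideanSpace.single i (1:ℝ) with hb
  have hbn : ∀ i, ‖L (b i)‖ = 1 := fun i => by rw [hL]; simp [hb]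
  have hbo : ∀ i j, i ≠ j → inner ℝ (L (b i)) (L (b j)) = 0 := fun i j hij => by
    rw [hLinn]; simp [hb, EuclideanSpace.inner_single_left, hij]
  obtain ⟨U, h1, h2, h3, hm, hn⟩ := j_U (L (b 0)) (L (b 2)) (hbn 0) (hbn 2) (hbo 0 2 (by decide))
  set σ1 : M2 := !![0,1;1,0] with hσ1
  set σ2 : M2 := !![0,-Complex.I; Complex.I,0] with hσ2
  set σ3 : M2 := !![1,0;0,-1] with hσ3
  have cm : jS (L (b 0)) = U * σ1 * Uᴴ := by rw [← hm, mul_assoc, h1, mul_one]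
  have cn : jS (L (b 2)) = U * σ3 * Uᴴ := by rw [← hn, mul_assoc, h1, mul_one]
  obtain ⟨G, cG⟩ : ∃ G : M2, jS (L (b 1)) = U * G * Uᴴ := by
    refine ⟨Uᴴ * jS (L (b 1)) * U, ?_⟩
    simp only [← mul_assoc]; rw [h1, one_mul, mul_assoc, h1, mul_one]
  have hconj : ∀ A B : M2, (U * A * Uᴴ) * (U * B * Uᴴ) = U * (A * B) * Uᴴ := by
    intro A B
    calc _ = U * A * (Uᴴ * U) * B * Uᴴ := by simp only [mul_assoc]
      _ = _ := by rw [h2]; simp only [mul_one, mul_assoc]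
  have hcinj : ∀ A B : M2, U * A * Uᴴ = U * B * Uᴴ → A = B := by
    intro A B h
    have := congrArg (fun X => Uᴴ * X * U) h
    simp only [← mul_assoc] at this
    rw [h2, one_mul, one_mul, mul_assoc, h2, mul_one, mul_assoc, h2, mul_one] at this
    exact this
  have a1 : G * σ1 = -(σ1 * G) := by
    have h := jS_anti0 _ _ (hbo 1 0 (by decide))
    rw [cm, cG, hconj, hconj, ← neg_mul, ← mul_neg] at h
    exact hcinj _ _ h
  have a3 : G * σ3 = -(σ3 * G) := by
    have h := jS_anti0 _ _ (hbo 1 2 (by decide))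
    rw [cn, cG, hconj, hconj, ← neg_mul, ← mul_neg] at h
    exact hcinj _ _ h
  have asq : G * G = 1 := by
    apply hcinj
    rw [← hconj, ← cG, jS_sq _ (hbn 1), mul_one, h1]
  have g00 : G 0 0 = 0 := by
    have := congrFun (congrFun a3 0) 0
    simp [hσ3, Matrix.mul_apply, Fin.sum_univ_two, Matrix.vecMul, dotProduct] at this
    linear_combination (1/2) * this
  have g11 : G 1 1 = 0 := by
    have := congrFun (congrFun a3 1) 1
    simp [hσ3, Matrix.mul_apply, Fin.sum_univ_two, Matrix.vecMul, dotProduct] at this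
    linear_combination -(1/2) * this
  have g01 : G 0 1 = - G 1 0 := by
    have := congrFun (congrFun a1 0) 0
    simpa [hσ1, Matrix.mul_apply, Fin.sum_univ_two, Matrix.vecMul, dotProduct] using this
  have gsq : G 1 0 ^ 2 = -1 := by
    have := congrFun (congrFun asq 0) 0
    simp [Matrix.mul_apply, Fin.sum_univ_two, g00, g01] at this
    linear_combination -this
  have hLb : ∀ v, jS (L v) = v 0 • jS (L (b 0)) + v 1 • jS (L (b 1)) + v 2 • jS (L (b 2)) := by
    intro v
    have : v = v 0 • b 0 + v 1 • b 1 + v 2 • b 2 := by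
      ext i; fin_cases i <;> simp [hb]
    conv_lhs => rw [this]
    simp only [map_add, map_smul]
  have hI : (G 1 0 - Complex.I) * (G 1 0 + Complex.I) = 0 := by
    linear_combination gsq - Complex.I_sq
  rcases mul_eq_zero.1 hI with h | h
  · have g10 : G 1 0 = Complex.I := sub_eq_zero.1 h
    have hGσ : G = σ2 := by
      ext i j; fin_cases i <;> fin_cases j <;> simp [hσ2, g00, g11, g01, g10]
    refine ⟨U, h1, h2, h3, Or.inl fun v => ?_⟩
    rw [hLb, cm, cn, cG, hGσ, jS_basis]
    simp only [mul_add, add_mul, mul_smul_comm, smul_mul_assoc, hσ1, hσ2, hσ3]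
  · have g10 : G 1 0 = -Complex.I := eq_neg_of_add_eq_zero_left h
    have hGσ : G = -σ2 := by
      ext i j; fin_cases i <;> fin_cases j <;> simp [hσ2, g00, g11, g01, g10]
    set J : M2 := !![0, -1; 1, 0] with hJ
    have hJJ : J * Jᴴ = 1 := by
      ext i j; fin_cases i <;> fin_cases j <;> simp [hJ, Matrix.mul_apply, Fin.sum_univ_two]
    refine ⟨U * J, ?_, ?_, ?_, Or.inr fun v => ?_⟩
    · rw [conjTranspose_mul]
      calc _ = U * (J * Jᴴ) * Uᴴ := by simp only [mul_assoc]
        _ = 1 := by rw [hJJ, mul_one, h1]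
    · rw [mul_eq_one_comm, conjTranspose_mul]
      calc _ = U * (J * Jᴴ) * Uᴴ := by simp only [mul_assoc]
        _ = 1 := by rw [hJJ, mul_one, h1]
    · rw [det_mul, h3, hJ]; simp [Matrix.det_fin_two]
    · have hJc : J * (- jS v) * Jᴴ = v 0 • σ1 + v 1 • (-σ2) + v 2 • σ3 := by
        ext i j; fin_cases i <;> fin_cases j <;>
          simp [hJ, jS_apply, hσ1, hσ2, hσ3, Matrix.mul_apply, Fin.sum_univ_two, Matrix.vecMul, dotProduct] <;> ring
      rw [conjTranspose_mul]
      have : U * J * (-jS v) * (Jᴴ * Uᴴ) = U * (J * (- jS v) * Jᴴ) * Uᴴ := by simp only [mul_assoc]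
      rw [this, hJc, hLb, cm, cn, cG, hGσ]
      simp only [mul_add, add_mul, mul_smul_comm, smul_mul_assoc]


lemma j_exp_one (r : ℝ) : NormedSpace.exp (r • (1 : M2)) = Real.exp r • (1 : M2) := by
  rw [j_exp_invol 1 (mul_one 1), ← add_smul, Real.cosh_add_sinh]

lemma j_exp_split (r : ℝ) (w : M2) :
    NormedSpace.exp (r • (1 : M2) + w) = Real.exp r • NormedSpace.exp w := by
  rw [Matrix.exp_add_of_commute _ _ ((Commute.one_left w).smul_left r), j_exp_one, smul_mul_assoc, one_mul]

lemma j_det (v : E3) : (NormedSpace.exp (jS v)).det = 1 := by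
  have hn : ‖v‖ ^ 2 = v 0 ^ 2 + v 1 ^ 2 + v 2 ^ 2 := by
    rw [EuclideanSpace.norm_sq_eq, Fin.sum_univ_three]; simp
  have hk : Real.cosh ‖v‖ ^ 2 - (Real.sinh ‖v‖ / ‖v‖) ^ 2 * (v 0 ^ 2 + v 1 ^ 2 + v 2 ^ 2) = 1 := by
    rw [← hn]
    by_cases hv : ‖v‖ = 0
    · simp [hv]
    · rw [div_pow, div_mul_cancel₀ _ (pow_ne_zero 2 hv), Real.cosh_sq]; ring
  rw [j_exp_vec]
  generalize Real.cosh ‖v‖ = c at *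
  generalize Real.sinh ‖v‖ / ‖v‖ = k at *
  have hk' : (c : ℂ) ^ 2 - (k : ℂ) ^ 2 * ((v 0 : ℂ) ^ 2 + (v 1 : ℂ) ^ 2 + (v 2 : ℂ) ^ 2) = 1 := by
    exact_mod_cast hk
  rw [← hk', Matrix.det_fin_two, jS_apply]
  simp
  linear_combination (k : ℂ) ^ 2 * (v 1 : ℂ) ^ 2 * Complex.I_sq

lemma j_pd_sq (B : M2) (h : B.PosDef) : (B * B).PosDef := by
  have := Matrix.PosDef.one (n := Fin 2) (R := ℂ)
  have h2 := (Matrix.PosDef.conjTranspose_mul_self B (Matrix.mulVec_injective_of_isUnit h.isUnit))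
  rwa [h.isHermitian.eq] at h2

lemma j_scal_pd (P : M2) (hP : P.PosDef)
    (h : ∀ Q : M2, Q.PosDef → P * (Q * Q) * P = Q * (P * P) * Q) :
    ∃ μ : ℝ, 0 < μ ∧ P = μ • (1 : M2) := by
  have hpd : ∀ a b d : ℝ, 0 < a → 0 < a * d - b * b → (!![(a : ℂ), b; b, d] : M2).PosDef := by
    intro a b d ha hd
    rw [Matrix.posDef_iff_dotProduct_mulVec]
    constructor
    · ext i j; fin_cases i <;> fin_cases j <;> simp
    · intro x hx
      have key : star x ⬝ᵥ (!![(a : ℂ), b; b, d] : M2) *ᵥ x =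
          ((a * ((x 0).re ^ 2 + (x 0).im ^ 2) + d * ((x 1).re ^ 2 + (x 1).im ^ 2) +
            2 * b * ((x 0).re * (x 1).re + (x 0).im * (x 1).im) : ℝ) : ℂ) := by
        apply Complex.ext <;> simp [Matrix.mulVec, dotProduct, Fin.sum_univ_two, pow_two] <;> ring
      rw [key]
      norm_cast
      have e : a * (a * ((x 0).re ^ 2 + (x 0).im ^ 2) + d * ((x 1).re ^ 2 + (x 1).im ^ 2) +
            2 * b * ((x 0).re * (x 1).re + (x 0).im * (x 1).im)) =
          (a * (x 0).re + b * (x 1).re) ^ 2 + (a * (x 0).im + b * (x 1).im) ^ 2 +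
          (a * d - b * b) * ((x 1).re ^ 2 + (x 1).im ^ 2) := by ring
      refine pos_of_mul_pos_right (a := a) ?_ ha.le
      rw [e]
      by_cases h1 : (x 1) = 0
      · have h0 : x 0 ≠ 0 := fun h0 => hx (by ext i; fin_cases i <;> simp [h0, h1])
        have : 0 < (x 0).re ^ 2 + (x 0).im ^ 2 := by
          have := Complex.normSq_pos.2 h0
          rw [Complex.normSq_apply] at this; nlinarith
        simp only [h1, Complex.zero_re, Complex.zero_im]
        have : 0 < a ^ 2 * ((x 0).re ^ 2 + (x 0).im ^ 2) := by positivity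
        nlinarith
      · have : 0 < (x 1).re ^ 2 + (x 1).im ^ 2 := by
          have := Complex.normSq_pos.2 h1
          rw [Complex.normSq_apply] at this; nlinarith
        have := mul_pos hd this
        positivity
  have hH := hP.isHermitian
  have h00 := hH.apply 0 0
  have h11 := hH.apply 1 1
  have h10 := hH.apply 0 1
  have i0 : (P 0 0).im = 0 := by have := congrArg Complex.im h00; simp at this; linarith
  have i1 : (P 1 1).im = 0 := by have := congrArg Complex.im h11; simp at this; linarith
  have r1 : (P 1 0).re = (P 0 1).re := by have := congrArg Complex.re h10; simpa using this
  have m1 : (P 1 0).im = -(P 0 1).im := by have := congrArg Complex.im h10; simp at this; linarith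
  have p0 : 0 < (P 0 0).re := (Complex.lt_def.1 (hP.diag_pos (i := 0))).1
  have p1 : 0 < (P 1 1).re := (Complex.lt_def.1 (hP.diag_pos (i := 1))).1
  have a1 := congrFun (congrFun (h _ (hpd 2 0 1 (by norm_num) (by norm_num))) 0) 0
  have a2 := congrFun (congrFun (h _ (hpd 2 1 2 (by norm_num) (by norm_num))) 0) 0
  have b1 := congrArg Complex.re a1
  have b2 := congrArg Complex.re a2
  simp [Matrix.mul_apply, Matrix.vecMul, dotProduct, Fin.sum_univ_two, i0, i1, r1, m1] at b1 b2
  have z : (P 0 1).re ^ 2 + (P 0 1).im ^ 2 = 0 := by nlinarith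
  have zr : (P 0 1).re = 0 := by nlinarith [sq_nonneg (P 0 1).re, sq_nonneg (P 0 1).im]
  have zi : (P 0 1).im = 0 := by nlinarith [sq_nonneg (P 0 1).re, sq_nonneg (P 0 1).im]
  rw [zr, zi] at b2
  have hpr : (P 0 0).re = (P 1 1).re := by nlinarith
  refine ⟨(P 0 0).re, p0, ?_⟩
  ext i j; fin_cases i <;> fin_cases j <;> apply Complex.ext <;> simp [*]


lemma j_main (φ : M2 → M2)
    (hmaps : ∀ A : M2, A.PosDef → (φ A).PosDef)
    (hcont : ContinuousOn φ {A : M2 | A.PosDef})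
    (hinj : ∀ A B : M2, A.PosDef → B.PosDef → φ A = φ B → A = B)
    (hsurj : ∀ B : M2, B.PosDef → ∃ A : M2, A.PosDef ∧ φ A = B)
    (hjordan : ∀ A B : M2, A.PosDef → B.PosDef → φ (A * B * A) = φ A * φ B * φ A) :
    (∃ (U : M2) (c : ℝ),
      U * Uᴴ = 1 ∧ Uᴴ * U = 1 ∧ U.det = 1 ∧ c ≠ -(1/2) ∧
      ∀ A : M2, A.PosDef → φ A = ((A.det.re ^ c : ℝ) : ℂ) • (U * A * Uᴴ)) ∨
    (∃ (V : M2) (d : ℝ),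
      V * Vᴴ = 1 ∧ Vᴴ * V = 1 ∧ V.det = 1 ∧ d ≠ 1/2 ∧
      ∀ A : M2, A.PosDef → φ A = ((A.det.re ^ d : ℝ) : ℂ) • (V * A⁻¹ * Vᴴ)) := by
  obtain ⟨f, hf⟩ := jt_linear φ hmaps hcont hjordan
  have finj : ∀ X Y : selfAdjoint M2, f X = f Y → X = Y := by
    intro X Y h
    have h1 := (hf X).2
    rw [h, (hf Y).2] at h1
    have h2 := hinj _ _ (jt_exp_posDef _ Y.2) (jt_exp_posDef _ X.2) h1
    exact Subtype.ext (jt_exp_inj _ _ Y.2 X.2 h2).symm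
  let I : selfAdjoint M2 := 1
  have hI : (I : M2) = 1 := rfl
  have e1 : NormedSpace.exp (1 : M2) = Real.exp 1 • (1 : M2) := by
    have := j_exp_one 1
    rwa [one_smul] at this
  have hone : φ 1 = 1 := by
    have := (hf 0).2
    simpa using this.symm
  have hsq : ∀ B : M2, B.PosDef → φ (B * B) = φ B * φ B := by
    intro B hB
    have := hjordan B 1 hB Matrix.PosDef.one
    rwa [hone, mul_one, mul_one] at this
  obtain ⟨s, hs⟩ : ∃ s : ℝ, f I = s • (1 : M2) := by
    have hA : (NormedSpace.exp (1 : M2)).PosDef := jt_exp_posDef _ Matrix.isHermitian_one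
    obtain ⟨μ, hμ, h⟩ := j_scal_pd (φ (NormedSpace.exp (1 : M2))) (hmaps _ hA) (by
      intro Q hQ
      obtain ⟨B, hB, rfl⟩ := hsurj Q hQ
      rw [← hsq _ hB, ← hsq _ hA, ← hjordan _ _ hA (j_pd_sq B hB), ← hjordan _ _ hB (j_pd_sq _ hA)]
      congr 1
      rw [e1]
      simp [mul_assoc])
    refine ⟨Real.log μ, jt_exp_inj _ _ (hf I).1 (by rw [Matrix.IsHermitian, Matrix.conjTranspose_smul]; simp) ?_⟩
    rw [(hf I).2, hI, h, j_exp_one, Real.exp_log hμ]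
  have hs0 : s ≠ 0 := by
    rintro rfl
    have := finj I 0 (by rw [hs]; simp)
    have := congrArg Subtype.val this
    change (1 : M2) = 0 at this
    exact one_ne_zero this
  let S : E3 →ₗ[ℝ] selfAdjoint M2 :=
    { toFun := fun v => ⟨jS v, jS_herm v⟩
      map_add' := fun v w => Subtype.ext (map_add jS v w)
      map_smul' := fun r v => Subtype.ext (map_smul jS r v) }
  have hSv : ∀ v, (S v : M2) = jS v := fun v => rfl
  let L : E3 →ₗ[ℝ] E3 := jT ∘ₗ f.toLinearMap ∘ₗ S
  let τ : E3 →ₗ[ℝ] ℝ := jt ∘ₗ f.toLinearMap ∘ₗ S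
  have hdec : ∀ v, f (S v) = τ v • (1 : M2) + jS (L v) := fun v => j_decomp _ (hf (S v)).1
  have hφS : ∀ v, φ (NormedSpace.exp (jS v)) = Real.exp (τ v) • NormedSpace.exp (jS (L v)) := by
    intro v
    rw [← j_exp_split, ← hdec, (hf (S v)).2, hSv]
  have hrel : ∀ u v w, NormedSpace.exp (jS u) * NormedSpace.exp (jS v) * NormedSpace.exp (jS u) = NormedSpace.exp (jS w) →
      Real.exp (τ w) • NormedSpace.exp (jS (L w)) = (Real.exp (τ u) * Real.exp (τ v) * Real.exp (τ u)) •
      (NormedSpace.exp (jS (L u)) * NormedSpace.exp (jS (L v)) * NormedSpace.exp (jS (L u))) := by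
    intro u v w h
    rw [← hφS, ← h, hjordan _ _ (jt_exp_posDef _ (jS_herm u)) (jt_exp_posDef _ (jS_herm v)), hφS, hφS]
    simp only [smul_mul_assoc, mul_smul_comm, smul_smul]
    congr 1; ring
  have hLinj : ∀ v, L v = 0 → v = 0 := by
    intro v hv
    have h1 : f (S v) = f ((τ v / s) • I) := by
      rw [hdec, hv, map_zero, add_zero, map_smul, hs, smul_smul, div_mul_cancel₀ _ hs0]
    have h2 := congrArg Subtype.val (finj _ _ h1)
    change jS v = (τ v / s) • (1 : M2) at h2
    have h3 := congrArg jT h2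
    rwa [jTS, map_smul, jT1, smul_zero] at h3
  obtain ⟨hL, hτ⟩ := j_core L τ hrel hLinj
  obtain ⟨U, hU1, hU2, hU3, hU⟩ := j_lift L hL
  have hpar : ∀ A : M2, A.PosDef → ∃ (t : ℝ) (v : E3), A = Real.exp t • NormedSpace.exp (jS v) ∧
      φ A = Real.exp (t * s) • NormedSpace.exp (jS (L v)) ∧ A.det.re = Real.exp (2 * t) := by
    intro A hA
    have hd := j_decomp _ (jt_log_herm A)
    set t := jt (CFC.log A)
    set v := jT (CFC.log A)
    have hAe : A = Real.exp t • NormedSpace.exp (jS v) := by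
      rw [← j_exp_split, ← hd, jt_exp_log A hA]
    refine ⟨t, v, hAe, ?_, ?_⟩
    · have h1 := (hf (t • I + S v)).2
      have h2 : ((t • I + S v : selfAdjoint M2) : M2) = CFC.log A := by rw [hd]; rfl
      rw [h2, jt_exp_log A hA, map_add, map_smul, hs, hdec, hτ, LinearMap.zero_apply, zero_smul, zero_add,
        smul_smul, j_exp_split] at h1
      exact h1.symm
    · rw [hAe, Matrix.det_smul_of_tower, j_det, Fintype.card_fin, ← Real.exp_nat_mul, Complex.smul_re]
      simp
  have hUu : IsUnit U := ⟨⟨U, Uᴴ, hU1, hU2⟩, rfl⟩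
  have hUi : U⁻¹ = Uᴴ := Matrix.inv_eq_right_inv hU1
  have hconj : ∀ X : M2, NormedSpace.exp (U * X * Uᴴ) = U * NormedSpace.exp X * Uᴴ := by
    intro X
    rw [← hUi]; exact Matrix.exp_conj U X hUu
  rcases hU with hU | hU
  · left
    refine ⟨U, (s - 1) / 2, hU1, hU2, hU3, fun h => hs0 (by linarith), fun A hA => ?_⟩
    obtain ⟨t, v, h1, h2, h3⟩ := hpar A hA
    rw [h2, h3, hU, hconj, ← Real.exp_mul, h1]
    rw [Complex.coe_smul, mul_smul_comm, smul_mul_assoc, smul_smul, ← Real.exp_add]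
    congr 2; ring
  · right
    refine ⟨U, (s + 1) / 2, hU1, hU2, hU3, fun h => hs0 (by linarith), fun A hA => ?_⟩
    obtain ⟨t, v, h1, h2, h3⟩ := hpar A hA
    have hinv : A⁻¹ = Real.exp (-t) • NormedSpace.exp (-jS v) := by
      apply Matrix.inv_eq_right_inv
      rw [h1, smul_mul_smul_comm, ← Real.exp_add, ← Matrix.exp_add_of_commute _ _ (Commute.refl (jS v)).neg_right]
      simp
    rw [h2, h3, hU, hconj, ← Real.exp_mul, hinv]
    rw [Complex.coe_smul, mul_smul_comm, smul_mul_assoc, smul_smul, ← Real.exp_add]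
    congr 2; ring


end JTLemmas

/-- Structure of continuous Jordan triple automorphisms of ℙ₂. -/
theorem jordan_triple_automorphisms_P2
    (φ : Matrix (Fin 2) (Fin 2) ℂ → Matrix (Fin 2) (Fin 2) ℂ)
    (hmaps : ∀ A : Matrix (Fin 2) (Fin 2) ℂ, A.PosDef → (φ A).PosDef)
    (hcont : ContinuousOn φ {A : Matrix (Fin 2) (Fin 2) ℂ | A.PosDef})
    (hinj : ∀ A B : Matrix (Fin 2) (Fin 2) ℂ, A.PosDef → B.PosDef →
      φ A = φ B → A = B)
    (hsurj : ∀ B : Matrix (Fin 2) (Fin 2) ℂ, B.PosDef →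
      ∃ A : Matrix (Fin 2) (Fin 2) ℂ, A.PosDef ∧ φ A = B)
    (hjordan : ∀ A B : Matrix (Fin 2) (Fin 2) ℂ, A.PosDef → B.PosDef →
      φ (A * B * A) = φ A * φ B * φ A) :
    (∃ (U : Matrix (Fin 2) (Fin 2) ℂ) (c : ℝ),
      U * Uᴴ = 1 ∧ Uᴴ * U = 1 ∧ U.det = 1 ∧ c ≠ -(1/2) ∧
      ∀ A : Matrix (Fin 2) (Fin 2) ℂ, A.PosDef →
        φ A = ((A.det.re ^ c : ℝ) : ℂ) • (U * A * Uᴴ)) ∨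
    (∃ (V : Matrix (Fin 2) (Fin 2) ℂ) (d : ℝ),
      V * Vᴴ = 1 ∧ Vᴴ * V = 1 ∧ V.det = 1 ∧ d ≠ 1/2 ∧
      ∀ A : Matrix (Fin 2) (Fin 2) ℂ, A.PosDef →
        φ A = ((A.det.re ^ d : ℝ) : ℂ) • (V * A⁻¹ * Vᴴ)) := by
  exact j_main φ hmaps hcont hinj hsurj hjordan
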